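/- Let t ↦ T_t be a map from an open real interval into the J-unitary operators on K which is differentiable in operator norm at a point t₀, with derivative Ṫ. Write T_{t₀} = [[a,b],[c,d]] and set A = [[1,0],[−d^{-1}c, d^{-1}]]. Then t ↦ V(T_t) is differentiable in operator norm at t₀ and V(T_{t₀})* · (d/dt V(T_t))|_{t=t₀} = A* (T_{t₀}* J Ṫ) A. -/

import Mathlib

noncomputable section

open ContinuousLinearMap

variable {H : Type*} [NormedAddCommGroup H] [InnerProductSpace ℂ H] [CompleteSpace H]
  [TopologicalSpace.SeparableSpace H]

local notation "K" => WithLp 2 (H × H)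

/-- The 2×2 block operator `[[a,b],[c,d]]` on `K = H ⊕ H`. -/
def blk (a b c d : H →L[ℂ] H) : K →L[ℂ] K :=
  (((WithLp.prodContinuousLinearEquiv 2 ℂ H H).symm : (H × H) →L[ℂ] K).comp
      ((((a.comp (fst ℂ H H)) + (b.comp (snd ℂ H H))).prod
        ((c.comp (fst ℂ H H)) + (d.comp (snd ℂ H H)))))).comp
    ((WithLp.prodContinuousLinearEquiv 2 ℂ H H : K →L[ℂ] (H × H)))

/-- The fundamental symmetry `J = [[1,0],[0,-1]]`. -/
def fundJ : K →L[ℂ] K := blk 1 0 0 (-1)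

/-- A bounded operator `T` on the Krein space `(K, J)` is `J`-unitary if it is invertible
and `T* J T = J`. -/
def IsJUnitary (T : K →L[ℂ] K) : Prop :=
  IsUnit T ∧ star T * fundJ * T = fundJ

/-- Embedding of `H` into the first summand of `K = H ⊕ H`. -/
def embFst : H →L[ℂ] K :=
  ((WithLp.prodContinuousLinearEquiv 2 ℂ H H).symm : (H × H) →L[ℂ] K).comp (inl ℂ H H)

/-- Embedding of `H` into the second summand of `K = H ⊕ H`. -/
def embSnd : H →L[ℂ] K :=
  ((WithLp.prodContinuousLinearEquiv 2 ℂ H H).symm : (H × H) →L[ℂ] K).comp (inr ℂ H H)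

/-- Projection onto the first summand of `K = H ⊕ H`. -/
def projFst : K →L[ℂ] H :=
  (fst ℂ H H).comp ((WithLp.prodContinuousLinearEquiv 2 ℂ H H : K →L[ℂ] (H × H)))

/-- Projection onto the second summand of `K = H ⊕ H`. -/
def projSnd : K →L[ℂ] H :=
  (snd ℂ H H).comp ((WithLp.prodContinuousLinearEquiv 2 ℂ H H : K →L[ℂ] (H × H)))

/-- The four blocks of an operator on `K = H ⊕ H`. -/
def blkA (T : K →L[ℂ] K) : H →L[ℂ] H := projFst ∘L (T ∘L embFst)
def blkB (T : K →L[ℂ] K) : H →L[ℂ] H := projFst ∘L (T ∘L embSnd)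
def blkC (T : K →L[ℂ] K) : H →L[ℂ] H := projSnd ∘L (T ∘L embFst)
def blkD (T : K →L[ℂ] K) : H →L[ℂ] H := projSnd ∘L (T ∘L embSnd)

/-- The unitary `V(T) = [[(a*)⁻¹, bd⁻¹],[−d⁻¹c, d⁻¹]]` associated to a `J`-unitary
`T = [[a,b],[c,d]]`. -/
def Vop (T : K →L[ℂ] K) : K →L[ℂ] K :=
  blk (Ring.inverse (star (blkA T))) (blkB T * Ring.inverse (blkD T))
    (-(Ring.inverse (blkD T) * blkC T)) (Ring.inverse (blkD T))

section

omit [TopologicalSpace.SeparableSpace H]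

section

omit [CompleteSpace H]

theorem blk_apply (a b c d : H →L[ℂ] H) (x : K) :
    blk a b c d x = WithLp.toLp 2 (a x.fst + b x.snd, c x.fst + d x.snd) := rfl

theorem blk_mul (a b c d a' b' c' d' : H →L[ℂ] H) :
    blk a b c d * blk a' b' c' d' =
      blk (a * a' + b * c') (a * b' + b * d') (c * a' + d * c') (c * b' + d * d') := by
  ext x
  simp only [blk_apply, mul_apply_eq_comp, add_apply, WithLp.toLp_fst, WithLp.toLp_snd, map_add]
  congr 2 <;> abel

theorem blk_add (a b c d a' b' c' d' : H →L[ℂ] H) :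
    blk a b c d + blk a' b' c' d' = blk (a + a') (b + b') (c + c') (d + d') := by
  ext x
  simp only [blk_apply, add_apply, ← WithLp.toLp_add, Prod.mk_add_mk]
  congr 2 <;> abel

theorem blk_one : blk (1 : H →L[ℂ] H) 0 0 1 = 1 := by
  ext x
  exact WithLp.ofLp_injective 2 (by ext <;> simp [blk_apply])

theorem blkA_blk (a b c d : H →L[ℂ] H) : blkA (blk a b c d) = a := by
  ext x; simp [blkA, blk, projFst, embFst]

theorem blkB_blk (a b c d : H →L[ℂ] H) : blkB (blk a b c d) = b := by
  ext x; simp [blkB, blk, projFst, embSnd]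

theorem blkC_blk (a b c d : H →L[ℂ] H) : blkC (blk a b c d) = c := by
  ext x; simp [blkC, blk, projSnd, embFst]

theorem blkD_blk (a b c d : H →L[ℂ] H) : blkD (blk a b c d) = d := by
  ext x; simp [blkD, blk, projSnd, embSnd]

theorem blk_blocks (T : K →L[ℂ] K) : blk (blkA T) (blkB T) (blkC T) (blkD T) = T := by
  ext x
  have hx : x = embFst x.fst + embSnd x.snd :=
    WithLp.ofLp_injective 2 (by ext <;> simp [embFst, embSnd])
  conv_rhs => rw [hx, map_add]
  exact WithLp.ofLp_injective 2
    (by ext <;> simp [blk_apply, blkA, blkB, blkC, blkD, projFst, projSnd])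

theorem blk_inj {a b c d a' b' c' d' : H →L[ℂ] H} (h : blk a b c d = blk a' b' c' d') :
    a = a' ∧ b = b' ∧ c = c' ∧ d = d' :=
  ⟨by simpa [blkA_blk] using congrArg blkA h, by simpa [blkB_blk] using congrArg blkB h,
    by simpa [blkC_blk] using congrArg blkC h, by simpa [blkD_blk] using congrArg blkD h⟩

theorem fundJ_mul_fundJ : (fundJ * fundJ : K →L[ℂ] K) = 1 := by
  simp [fundJ, blk_mul, blk_one]

/-- The operator `[[1,0],[c,d]]` is inverted by `[[1,0],[−d⁻¹c,d⁻¹]]`. -/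
theorem blk_lower_mul_inverse (c : H →L[ℂ] H) {d : H →L[ℂ] H} (hd : IsUnit d) :
    blk 1 0 c d * blk 1 0 (-(Ring.inverse d * c)) (Ring.inverse d) = 1 := by
  simp [blk_mul, ← mul_assoc, Ring.mul_inverse_cancel _ hd, ← blk_one]

theorem blk_inverse_mul_lower (c : H →L[ℂ] H) {d : H →L[ℂ] H} (hd : IsUnit d) :
    blk 1 0 (-(Ring.inverse d * c)) (Ring.inverse d) * blk 1 0 c d = 1 := by
  simp [blk_mul, Ring.inverse_mul_cancel _ hd, ← blk_one]

theorem inverse_blk_lower (c : H →L[ℂ] H) {d : H →L[ℂ] H} (hd : IsUnit d) :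
    Ring.inverse (blk 1 0 c d) = blk 1 0 (-(Ring.inverse d * c)) (Ring.inverse d) :=
  Ring.inverse_unit ⟨_, _, blk_lower_mul_inverse c hd, blk_inverse_mul_lower c hd⟩

theorem proj_mul_blk_add (a b c d : H →L[ℂ] H) :
    blk 1 0 0 0 * blk a b c d + blk 0 0 0 1 = blk a b 0 1 := by
  simp [blk_mul, blk_add]

theorem proj_add_mul_blk (a b c d : H →L[ℂ] H) :
    blk 1 0 0 0 + blk 0 0 0 1 * blk a b c d = blk 1 0 c d := by
  simp [blk_mul, blk_add]

end

theorem star_blk (a b c d : H →L[ℂ] H) :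
    star (blk a b c d) = blk (star a) (star c) (star b) (star d) := by
  refine Eq.symm ((ContinuousLinearMap.eq_adjoint_iff _ _).2 ?_)
  intro x y
  simp [blk_apply, WithLp.prod_inner_apply, star_eq_adjoint, inner_add_left, inner_add_right,
    adjoint_inner_left]
  abel

/-- The adjoint of a `J`-unitary operator is `J`-unitary. -/
theorem IsJUnitary.mul_fundJ_mul_star {T : K →L[ℂ] K} (h : IsJUnitary T) :
    T * fundJ * star T = fundJ := by
  obtain ⟨⟨u, rfl⟩, h⟩ := h
  have hl : fundJ * star (u : K →L[ℂ] K) * fundJ * (u : K →L[ℂ] K) = 1 := by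
    rw [mul_assoc fundJ, mul_assoc fundJ, h, fundJ_mul_fundJ]
  have hi : fundJ * star (u : K →L[ℂ] K) * fundJ = (↑u⁻¹ : K →L[ℂ] K) := Units.eq_inv_of_mul_eq_one_right hl
  have hr : (u : K →L[ℂ] K) * (fundJ * star (u : K →L[ℂ] K) * fundJ) = 1 := by
    rw [hi, Units.mul_inv]
  calc (u : K →L[ℂ] K) * fundJ * star (u : K →L[ℂ] K)
      = (u : K →L[ℂ] K) * (fundJ * star (u : K →L[ℂ] K) * fundJ) * fundJ := by
        simp only [mul_assoc, fundJ_mul_fundJ, mul_one]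
    _ = fundJ := by rw [hr, one_mul]

theorem isUnit_one_add_star_mul_self (b : H →L[ℂ] H) : IsUnit (1 + star b * b) :=
  CStarAlgebra.isUnit_of_le 1 (le_add_of_nonneg_right (star_mul_self_nonneg b)) (by simp)

theorem isUnit_of_star_mul_self_of_self_mul_star {d x y : H →L[ℂ] H}
    (h₁ : star d * d = 1 + star x * x) (h₂ : d * star d = 1 + y * star y) : IsUnit d := by
  have u₁ := isUnit_one_add_star_mul_self x
  have u₂ := isUnit_one_add_star_mul_self (star y)
  rw [star_star, ← h₂] at u₂
  rw [← h₁] at u₁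
  obtain ⟨v, hv⟩ := u₁
  obtain ⟨w, hw⟩ := u₂
  refine isUnit_iff_exists_and_exists.2 ⟨⟨star d * ↑w⁻¹, ?_⟩, ⟨↑v⁻¹ * star d, ?_⟩⟩
  · rw [← mul_assoc, ← hw, Units.mul_inv]
  · rw [mul_assoc, ← hv, Units.inv_mul]

theorem IsJUnitary.blk_relations {a b c d : H →L[ℂ] H} (h : IsJUnitary (blk a b c d)) :
    IsUnit a ∧ IsUnit d ∧ star a * a = 1 + star c * c ∧ star a * b = star c * d := by
  have h₁ := h.2
  have h₂ := h.mul_fundJ_mul_star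
  simp only [fundJ, star_blk, blk_mul] at h₁ h₂
  obtain ⟨haa, hab, -, hdd⟩ := blk_inj h₁
  obtain ⟨haa', -, -, hdd'⟩ := blk_inj h₂
  simp only [mul_one, mul_zero, add_zero, zero_add, mul_neg, neg_mul] at haa hab hdd haa' hdd'
  rw [← sub_eq_add_neg, sub_eq_iff_eq_add] at haa haa'
  rw [← sub_eq_add_neg, sub_eq_zero] at hab
  have hd₁ : star d * d = 1 + star b * b := by
    rw [← neg_eq_iff_eq_neg.2 hdd]; abel
  have hd₂ : d * star d = 1 + c * star c := by
    rw [← neg_eq_iff_eq_neg.2 hdd']; abel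
  exact ⟨isUnit_of_star_mul_self_of_self_mul_star haa haa',
    isUnit_of_star_mul_self_of_self_mul_star hd₁ hd₂, haa, hab⟩

theorem inverse_star_eq_schur {a b c d : H →L[ℂ] H} (h : IsJUnitary (blk a b c d)) :
    Ring.inverse (star a) = a - b * Ring.inverse d * c := by
  obtain ⟨ha, hd, haa, hab⟩ := h.blk_relations
  have key : star a * (a - b * Ring.inverse d * c) = 1 := by
    rw [mul_sub, haa, ← mul_assoc, ← mul_assoc, hab, mul_assoc (star c),
      Ring.mul_inverse_cancel _ hd, mul_one, add_sub_cancel_right]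
  calc Ring.inverse (star a)
      = Ring.inverse (star a) * (star a * (a - b * Ring.inverse d * c)) := by rw [key, mul_one]
    _ = a - b * Ring.inverse d * c := by
      rw [← mul_assoc, Ring.inverse_mul_cancel _ ha.star, one_mul]

theorem Vop_blk {a b c d : H →L[ℂ] H} (h : IsJUnitary (blk a b c d)) :
    Vop (blk a b c d) =
      blk a b 0 1 * blk 1 0 (-(Ring.inverse d * c)) (Ring.inverse d) := by
  simp only [Vop, blkA_blk, blkB_blk, blkC_blk, blkD_blk, inverse_star_eq_schur h, blk_mul]
  simp [sub_eq_add_neg, mul_assoc]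

theorem Vop_eq {T : K →L[ℂ] K} (h : IsJUnitary T) :
    Vop T = (blk 1 0 0 0 * T + blk 0 0 0 1) *
      Ring.inverse (blk 1 0 0 0 + blk 0 0 0 1 * T) := by
  rw [← blk_blocks T] at h ⊢
  rw [Vop_blk h, proj_mul_blk_add, proj_add_mul_blk, inverse_blk_lower _ h.blk_relations.2.1]

theorem hasDerivAt_mul_inverse {R : Type*} [NormedRing R] [NormedAlgebra ℝ R] [CompleteSpace R]
    {f g : ℝ → R} {f' g' i : R} {t : ℝ} (hf : HasDerivAt f f' t) (hg : HasDerivAt g g' t)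
    (h₁ : g t * i = 1) (h₂ : i * g t = 1) :
    HasDerivAt (fun s => f s * Ring.inverse (g s)) ((f' - f t * i * g') * i) t := by
  have hi : Ring.inverse (g t) = i := Ring.inverse_unit ⟨g t, i, h₁, h₂⟩
  have hinv := (hasFDerivAt_ringInverse (𝕜 := ℝ) (⟨g t, i, h₁, h₂⟩ : Rˣ)).comp_hasDerivAt t hg
  refine (hf.mul hinv).congr_deriv ?_
  simp [hi, add_mul, mul_assoc, sub_eq_add_neg]

/-- The J-isometry relation says that `[[a,b],[0,1]]` and `[[1,0],[c,d]]` have the same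
modulus. -/
theorem IsJUnitary.star_mul_self_eq {a b c d : H →L[ℂ] H} (h : IsJUnitary (blk a b c d)) :
    star (blk a b 0 1) * blk a b 0 1 = star (blk 1 0 c d) * blk 1 0 c d := by
  have h₁ := h.2
  simp only [fundJ, star_blk, blk_mul] at h₁
  obtain ⟨haa, hab, hba, hdd⟩ := blk_inj h₁
  simp only [mul_one, mul_zero, add_zero, zero_add, mul_neg, neg_mul] at haa hab hba hdd
  rw [← sub_eq_add_neg, sub_eq_iff_eq_add] at haa hab hba hdd
  simp only [star_blk, blk_mul, haa, hab, hba, hdd]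
  simp

theorem IsJUnitary.star_mul_fundJ_eq {a b c d : H →L[ℂ] H} (h : IsJUnitary (blk a b c d)) :
    star (Vop (blk a b c d)) * (blk 1 0 0 0 - Vop (blk a b c d) * blk 0 0 0 1) =
      star (blk 1 0 (-(Ring.inverse d * c)) (Ring.inverse d)) *
        (star (blk a b c d) * fundJ) := by
  have hinv := blk_lower_mul_inverse c h.blk_relations.2.1
  rw [Vop_blk h]
  set A := blk 1 0 (-(Ring.inverse d * c)) (Ring.inverse d)
  have hcancel : star (blk a b 0 1) * (blk a b 0 1 * A * blk 0 0 0 1) =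
      star (blk 1 0 c d) * blk 0 0 0 1 := by
    rw [← mul_assoc, ← mul_assoc, h.star_mul_self_eq, mul_assoc (star _), hinv, mul_one]
  rw [star_mul, mul_assoc, mul_sub (star (blk a b 0 1)), hcancel]
  congr 1
  rw [sub_eq_iff_eq_add]
  simp [fundJ, star_blk, blk_mul, blk_add]

end

/-- Proposition 3.15 of the paper: for a differentiable path of
`J`-unitaries `t ↦ T_t` with `T_{t₀} = [[a,b],[c,d]]` and derivative `Ṫ` at `t₀`,
the path `t ↦ V(T_t)` is differentiable at `t₀` and, with
`A = [[1,0],[−d⁻¹c, d⁻¹]]`, one has `V(T_{t₀})* (d/dt V(T_t))|_{t₀} = A* (T_{t₀}* J Ṫ) A`. -/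
theorem hasDerivAt_V (T : ℝ → (K →L[ℂ] K)) (I : Set ℝ) (hI : IsOpen I)
    (t₀ : ℝ) (ht₀ : t₀ ∈ I) (hJU : ∀ t ∈ I, IsJUnitary (T t))
    (Tdot : K →L[ℂ] K) (hderiv : HasDerivAt T Tdot t₀)
    (a b c d : H →L[ℂ] H) (hblk : T t₀ = blk a b c d) :
    ∃ Vdot : K →L[ℂ] K,
      HasDerivAt (fun t => Vop (T t)) Vdot t₀ ∧
      star (Vop (T t₀)) * Vdot =
        star (blk 1 0 (-(Ring.inverse d * c)) (Ring.inverse d))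
          * (star (T t₀) * fundJ * Tdot)
          * blk 1 0 (-(Ring.inverse d * c)) (Ring.inverse d) := by
  have hJ : IsJUnitary (blk a b c d) := hblk ▸ hJU t₀ ht₀
  have hd := hJ.blk_relations.2.1
  have hM : blk 1 0 0 0 + blk 0 0 0 1 * T t₀ = blk 1 0 c d := by rw [hblk, proj_add_mul_blk]
  have hN : blk 1 0 0 0 * T t₀ + blk 0 0 0 1 = blk a b 0 1 := by rw [hblk, proj_mul_blk_add]
  have key := hasDerivAt_mul_inverse
    ((hderiv.const_mul (blk 1 0 0 0)).add_const (blk 0 0 0 1))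
    ((hderiv.const_mul (blk 0 0 0 1)).const_add (blk 1 0 0 0))
    (by rw [hM]; exact blk_lower_mul_inverse c hd) (by rw [hM]; exact blk_inverse_mul_lower c hd)
  rw [hN, ← Vop_blk hJ, ← mul_assoc, ← sub_mul] at key
  refine ⟨_, key.congr_of_eventuallyEq ?_, ?_⟩
  · filter_upwards [hI.mem_nhds ht₀] with t ht using Vop_eq (hJU t ht)
  · rw [hblk, ← mul_assoc, ← mul_assoc, hJ.star_mul_fundJ_eq]
    simp only [mul_assoc]
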